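/- Approximate resonances of the multisoliton linearized equation: for every J ∈ ℕ there exist γ* > 0 and C > 0 such that for every λ = (λ₁,…,λ_J) with 0 < λ_J < … < λ₁ and γ(λ) ≤ γ*, the following holds for each 1 ≤ j ≤ J. If φ_j is the radial finite-energy solution of ∂_t²φ − Δφ + V_λ φ = 0 with data (φ_j(0), ∂_t φ_j(0)) = (0, (ΛW)_{[λ_j]}), and ψ_j is the one with data ((ΛW)_{(λ_j)}, 0), then sup_{t∈ℝ} ‖( φ_j(t) − t (ΛW)_{[λ_j]}, ∂_t φ_j(t) − (ΛW)_{[λ_j]} )‖_{ℋ_{|t|}} ≤ C γ(λ) and sup_{t∈ℝ} ‖( ψ_j(t) − (ΛW)_{(λ_j)}, ∂_t ψ_j(t) )‖_{ℋ_{|t|}} ≤ C γ(λ)² |log γ(λ)|. -/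

import Mathlib

open MeasureTheory Real Filter Set Topology ENNReal RealInnerProductSpace

noncomputable section

abbrev E6 := EuclideanSpace ℝ (Fin 6)

/-- The ground state `W(x) = (1+|x|²/24)⁻²` on `ℝ⁶`. -/
def W6 (x : E6) : ℝ := ((1 + ‖x‖ ^ 2 / 24) ^ 2)⁻¹

/-- The potential `V = -2W` of the linearized equation. -/
def V6 (x : E6) : ℝ := -2 * W6 x

/-- `ΛW(x) = x·∇W(x) + 2W(x)`. -/
def LW6 (x : E6) : ℝ := fderiv ℝ W6 x x + 2 * W6 x

/-- The Laplacian of `f : ℝ⁶ → ℝ`. -/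
def lap6 (f : E6 → ℝ) (x : E6) : ℝ :=
  ∑ i : Fin 6, fderiv ℝ (fun y => fderiv ℝ f y (EuclideanSpace.single i 1)) x
    (EuclideanSpace.single i 1)

/-- `∂ₜ u`. -/
def dtu (u : ℝ → E6 → ℝ) (t : ℝ) (x : E6) : ℝ := deriv (fun s => u s x) t

/-- `∂ₜ² u`. -/
def dttu (u : ℝ → E6 → ℝ) (t : ℝ) (x : E6) : ℝ := deriv (fun s => dtu u s x) t

/-- `|∇_{t,x} u|² = (∂ₜ u)² + |∇u|²`. -/
def eDensity (u : ℝ → E6 → ℝ) (t : ℝ) (x : E6) : ℝ :=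
  dtu u t x ^ 2 + ‖gradient (u t) x‖ ^ 2

/-- `u` is a radial finite-energy solution of `∂ₜ²u - Δu + P·u = 0` on `ℝ × ℝ⁶`. -/
def IsRadSolOf (P : E6 → ℝ) (u : ℝ → E6 → ℝ) : Prop :=
  ContDiff ℝ 2 (fun p : ℝ × E6 => u p.1 p.2) ∧
  (∀ t x y, ‖x‖ = ‖y‖ → u t x = u t y) ∧
  (∀ t x, dttu u t x - lap6 (u t) x + P x * u t x = 0) ∧
  Integrable (fun x => eDensity u 0 x)

/-- `Ḣ¹`-invariant rescaling `f_{(λ)}(x) = λ⁻² f(x/λ)`. -/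
def rescH (lam : ℝ) (f : E6 → ℝ) (x : E6) : ℝ := (lam ^ 2)⁻¹ * f (lam⁻¹ • x)

/-- `L²`-invariant rescaling `f_{[λ]}(x) = λ⁻³ f(x/λ)`. -/
def rescL (lam : ℝ) (f : E6 → ℝ) (x : E6) : ℝ := (lam ^ 3)⁻¹ * f (lam⁻¹ • x)

/-- The multisoliton potential `V_λ = Σ_j V_{(λ_j)}`. -/
def Vmulti {J : ℕ} (lam : Fin J → ℝ) (x : E6) : ℝ := ∑ j, rescH (lam j) V6 x

/-- The scale separation parameter `γ(λ) = max_{1≤j≤J-1} λ_{j+1}/λ_j`. -/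
def gam {J : ℕ} (lam : Fin J → ℝ) : ℝ :=
  sSup {g | ∃ (j : Fin J) (h : (j : ℕ) + 1 < J), g = lam ⟨(j : ℕ) + 1, h⟩ / lam j}

/-- The `Z_{-3,λ}` norm of a function on `ℝ⁶`:
`sup_{R>0} (inf_j ⟨log(R/λ_j)⟩)⁻¹ (∫_{R<|x|<2R} f²)^{1/2}`. -/
def ZlamE {J : ℕ} (lam : Fin J → ℝ) (f : E6 → ℝ) : ℝ≥0∞ :=
  ⨆ R : {R : ℝ // 0 < R}, ENNReal.ofReal
    ((⨅ j, Real.sqrt (1 + Real.log (R.1 / lam j) ^ 2))⁻¹ *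
      Real.sqrt (∫ x in {x : E6 | R.1 < ‖x‖ ∧ ‖x‖ < 2 * R.1}, f x ^ 2))

/-- `v` belongs to `span((ΛW)_{[λ_j]}, 1 ≤ j ≤ J)`. -/
def InSpanL {J : ℕ} (lam : Fin J → ℝ) (v : E6 → ℝ) : Prop :=
  ∃ c : Fin J → ℝ, v = fun x => ∑ j, c j * rescL (lam j) LW6 x

/-- `w` belongs to `span((ΛW)_{(λ_j)}, 1 ≤ j ≤ J)`. -/
def InSpanH {J : ℕ} (lam : Fin J → ℝ) (w : E6 → ℝ) : Prop :=
  ∃ c : Fin J → ℝ, w = fun x => ∑ j, c j * rescH (lam j) LW6 x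

lemma hasDerivAt_integral_of_contDiff_one {q : ℝ × ℝ → ℝ} (hq : ContDiff ℝ 1 q) (t : ℝ) :
    HasDerivAt (fun s => ∫ θ in (0 : ℝ)..1, q (s, θ))
      (∫ θ in (0 : ℝ)..1, fderiv ℝ q (t, θ) (1, 0)) t := by
  have hq' : Continuous fun p : ℝ × ℝ => fderiv ℝ q p (1, 0) :=
    (hq.continuous_fderiv (by simp)).clm_apply continuous_const
  obtain ⟨C, hC⟩ := ((isCompact_closedBall t 1).prod
    (isCompact_Icc (a := (0 : ℝ)) (b := 1))).exists_bound_of_continuousOn hq'.continuousOn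
  refine (intervalIntegral.hasDerivAt_integral_of_dominated_loc_of_deriv_le (μ := volume)
    (F := fun s θ => q (s, θ)) (F' := fun s θ => fderiv ℝ q (s, θ) (1, 0)) (bound := fun _ => C)
    (Metric.closedBall_mem_nhds t one_pos) ?_ ?_ ?_ ?_ ?_ ?_).2
  · exact .of_forall fun s => (hq.continuous.comp (by fun_prop)).aestronglyMeasurable
  · exact (hq.continuous.comp (by fun_prop)).intervalIntegrable _ _
  · exact (hq'.comp (by fun_prop : Continuous fun θ : ℝ => (t, θ))).aestronglyMeasurable
  · refine .of_forall fun θ hθ s hs => hC (s, θ) ⟨hs, ?_⟩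
    rw [uIoc_of_le zero_le_one] at hθ
    exact ⟨hθ.1.le, hθ.2⟩
  · exact intervalIntegrable_const
  · refine .of_forall fun θ _ s _ => ?_
    have h1 := (hq.differentiable (by simp) (s, θ)).hasFDerivAt
    exact h1.comp_hasDerivAt s ((hasDerivAt_id s).prodMk (hasDerivAt_const s θ))

lemma fderiv_mixed_comm {v : ℝ × ℝ → ℝ} (hv : ContDiff ℝ 2 v) (p a b : ℝ × ℝ) :
    fderiv ℝ (fun z => fderiv ℝ v z a) p b = fderiv ℝ (fun z => fderiv ℝ v z b) p a := by
  have hd : DifferentiableAt ℝ (fderiv ℝ v) p :=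
    (hv.fderiv_right (m := 1) (by norm_num)).differentiable (by simp) p
  have hs := hv.contDiffAt (x := p) |>.isSymmSndFDerivAt (by simp)
  rw [fderiv_clm_apply hd (by fun_prop), fderiv_clm_apply hd (by fun_prop)]
  simpa using hs.eq b a

lemma contDiff_fderiv_apply_const {E : Type*} [NormedAddCommGroup E] [NormedSpace ℝ E]
    {v : E → ℝ} (hv : ContDiff ℝ 2 v) (a : E) :
    ContDiff ℝ 1 fun z => fderiv ℝ v z a :=
  (hv.fderiv_right (m := 1) (by norm_num)).clm_apply contDiff_const

lemma hasDerivAt_comp_curve {f : ℝ × ℝ → ℝ} (hf : ContDiff ℝ 1 f) {x y : ℝ → ℝ} {x' y' s : ℝ}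
    (hx : HasDerivAt x x' s) (hy : HasDerivAt y y' s) :
    HasDerivAt (fun s => f (x s, y s))
      (x' * fderiv ℝ f (x s, y s) (1, 0) + y' * fderiv ℝ f (x s, y s) (0, 1)) s := by
  have h := ((hf.differentiable (by simp) (x s, y s)).hasFDerivAt).comp_hasDerivAt s
    (hx.prodMk hy)
  have e : ((x', y') : ℝ × ℝ) = x' • ((1 : ℝ), (0 : ℝ)) + y' • ((0 : ℝ), (1 : ℝ)) := by simp
  rw [e, map_add, map_smul, map_smul] at h
  exact h

/-- The time derivative of a function of `(t, r)`. -/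
def partialT (v : ℝ × ℝ → ℝ) (z : ℝ × ℝ) : ℝ := fderiv ℝ v z (1, 0)

/-- The radial derivative of a function of `(t, r)`. -/
def partialR (v : ℝ × ℝ → ℝ) (z : ℝ × ℝ) : ℝ := fderiv ℝ v z (0, 1)

/-- The energy density, in dimension `6`, augmented by the zero-order term `p(t)² v²`. -/
def radDensity (p : ℝ → ℝ) (v : ℝ × ℝ → ℝ) (z : ℝ × ℝ) : ℝ :=
  (partialT v z ^ 2 + partialR v z ^ 2 + p z.1 ^ 2 * v z ^ 2) * z.2 ^ 5

/-- The energy on `t < r < R - t`, written as an integral over `[0, 1]`. -/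
def coneEnergy (p : ℝ → ℝ) (v : ℝ × ℝ → ℝ) (R t : ℝ) : ℝ :=
  ∫ θ in (0 : ℝ)..1, radDensity p v (t, t + θ * (R - 2 * t)) * (R - 2 * t)

lemma contDiff_partialT {v : ℝ × ℝ → ℝ} (hv : ContDiff ℝ 2 v) : ContDiff ℝ 1 (partialT v) :=
  contDiff_fderiv_apply_const hv _

lemma contDiff_partialR {v : ℝ × ℝ → ℝ} (hv : ContDiff ℝ 2 v) : ContDiff ℝ 1 (partialR v) :=
  contDiff_fderiv_apply_const hv _

lemma contDiff_radDensity {p : ℝ → ℝ} {v : ℝ × ℝ → ℝ} (hp : ContDiff ℝ 1 p)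
    (hv : ContDiff ℝ 2 v) : ContDiff ℝ 1 (radDensity p v) := by
  have h1 := contDiff_partialT hv
  have h2 := contDiff_partialR hv
  have h3 : ContDiff ℝ 1 v := hv.of_le (by norm_num)
  unfold radDensity
  fun_prop

lemma hasDerivAt_partialT_left {f : ℝ × ℝ → ℝ} (hf : ContDiff ℝ 1 f) (t r : ℝ) :
    HasDerivAt (fun s => f (s, r)) (partialT f (t, r)) t := by
  simpa [partialT] using hasDerivAt_comp_curve hf (hasDerivAt_id t) (hasDerivAt_const t r)

lemma hasDerivAt_partialR_right {f : ℝ × ℝ → ℝ} (hf : ContDiff ℝ 1 f) (t r : ℝ) :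
    HasDerivAt (fun s => f (t, s)) (partialR f (t, r)) r := by
  simpa [partialR] using hasDerivAt_comp_curve hf (hasDerivAt_const r t) (hasDerivAt_id r)

lemma continuous_partialT {f : ℝ × ℝ → ℝ} (hf : ContDiff ℝ 1 f) : Continuous (partialT f) :=
  (hf.continuous_fderiv (by simp)).clm_apply continuous_const

lemma continuous_partialR {f : ℝ × ℝ → ℝ} (hf : ContDiff ℝ 1 f) : Continuous (partialR f) :=
  (hf.continuous_fderiv (by simp)).clm_apply continuous_const

lemma flux_pointwise {a b w att abt brr P P' V F r c : ℝ} (hr : 0 < r) (hP : 0 ≤ P)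
    (hP' : P' ≤ 0) (hV : |V| ≤ P ^ 2) (hc : 0 < c)
    (hpde : att - brr - 5 / r * b + V * w = F) :
    (2 * a * att + 2 * b * abt + (2 * P * P' * w ^ 2 + P ^ 2 * (2 * w * a))) * r ^ 5 ≤
      2 * (abt * b + a * brr) * r ^ 5 + 2 * (a * b) * (5 * r ^ 4) +
      ((2 * P + 1 / c) * (a ^ 2 + b ^ 2 + P ^ 2 * w ^ 2) + c * F ^ 2) * r ^ 5 := by
  have h1 : 2 * a * F ≤ c * F ^ 2 + 1 / c * a ^ 2 := by
    have : 0 ≤ 1 / c * (c * F - a) ^ 2 := by positivity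
    have e : 1 / c * (c * F - a) ^ 2 = c * F ^ 2 + 1 / c * a ^ 2 - 2 * a * F := by
      field_simp; ring
    linarith
  have h2 : 2 * P ^ 2 * w * a - 2 * a * V * w ≤ 2 * P * (a ^ 2 + P ^ 2 * w ^ 2) := by
    have hk : |w * a| * (2 * P ^ 2) ≤ P * (a ^ 2 + P ^ 2 * w ^ 2) := by
      rw [abs_mul]
      have : 0 ≤ P * (|a| - P * |w|) ^ 2 := by positivity
      have e : P * (|a| - P * |w|) ^ 2 =
          P * (|a| ^ 2 + P ^ 2 * |w| ^ 2) - |w| * |a| * (2 * P ^ 2) := by ring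
      rw [sq_abs, sq_abs] at e
      linarith
    have hl : -(a * V * w) ≤ |w * a| * P ^ 2 := by
      calc -(a * V * w) ≤ |a * V * w| := neg_le_abs _
        _ = |w * a| * |V| := by rw [abs_mul, abs_mul, abs_mul]; ring
        _ ≤ _ := by gcongr
    have hm : w * a * P ^ 2 ≤ |w * a| * P ^ 2 := by gcongr; exact le_abs_self _
    nlinarith
  have h3 : 2 * P * P' * w ^ 2 ≤ 0 := by
    have : 0 ≤ P * (-P') * w ^ 2 := mul_nonneg (mul_nonneg hP (by linarith)) (sq_nonneg w)
    linarith
  have h4 : 0 ≤ (2 * P + 1 / c) * b ^ 2 + 1 / c * (P ^ 2 * w ^ 2) := by positivity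
  have e1 : att = brr + 5 / r * b - V * w + F := by linarith
  have e2 : 2 * (a * b) * (5 * r ^ 4) = 2 * a * (5 / r * b) * r ^ 5 := by field_simp
  rw [e2, e1, ← add_mul, ← add_mul]
  refine mul_le_mul_of_nonneg_right ?_ (by positivity)
  nlinarith

lemma partialT_radDensity {p p' : ℝ → ℝ} {v : ℝ × ℝ → ℝ} (hp1 : ContDiff ℝ 1 p)
    (hp : ∀ t, HasDerivAt p (p' t) t) (hv : ContDiff ℝ 2 v) (t r : ℝ) :
    partialT (radDensity p v) (t, r) =
      (2 * partialT v (t, r) * partialT (partialT v) (t, r)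
        + 2 * partialR v (t, r) * partialR (partialT v) (t, r)
        + (2 * p t * p' t * v (t, r) ^ 2 + p t ^ 2 * (2 * v (t, r) * partialT v (t, r))))
        * r ^ 5 := by
  have h := hasDerivAt_partialT_left (contDiff_radDensity hp1 hv) t r
  refine h.unique ?_
  have a := hasDerivAt_partialT_left (contDiff_partialT hv) t r
  have b := hasDerivAt_partialT_left (contDiff_partialR hv) t r
  have w := hasDerivAt_partialT_left (hv.of_le (by norm_num : (1 : WithTop ℕ∞) ≤ 2)) t r
  have e : partialT (partialR v) (t, r) = partialR (partialT v) (t, r) :=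
    fderiv_mixed_comm hv (t, r) (0, 1) (1, 0)
  rw [e] at b
  have := (((a.pow 2).add (b.pow 2)).add (((hp t).pow 2).mul (w.pow 2))).mul_const (r ^ 5)
  refine this.congr_deriv ?_
  simp

lemma hasDerivAt_coneEnergy {p p' : ℝ → ℝ} {v : ℝ × ℝ → ℝ} {V : ℝ → ℝ} {F : ℝ → ℝ → ℝ}
    (hp1 : ContDiff ℝ 1 p) (hp : ∀ t, HasDerivAt p (p' t) t) (hp0 : ∀ t, 0 ≤ p t)
    (hp' : ∀ t, 0 ≤ t → p' t ≤ 0) (hVp : ∀ t r, 0 ≤ t → t ≤ r → |V r| ≤ p t ^ 2)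
    (hv : ContDiff ℝ 2 v)
    (hpde : ∀ t r, 0 < r → partialT (partialT v) (t, r) - partialR (partialR v) (t, r)
      - 5 / r * partialR v (t, r) + V r * v (t, r) = F t r)
    (hF : ∀ t, Continuous (F t)) (R t : ℝ) :
    ∃ E', HasDerivAt (coneEnergy p v R) E' t ∧
      (0 < t → t < R / 2 → ∀ c h : ℝ, 0 < c →
        (∫ r in t..(R - t), F t r ^ 2 * r ^ 5) ≤ h ^ 2 →
        E' ≤ (2 * p t + 1 / c) * coneEnergy p v R t + c * h ^ 2) := by
  set e := radDensity p v with he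
  have hec : ContDiff ℝ 1 e := contDiff_radDensity hp1 hv
  set q : ℝ × ℝ → ℝ := fun z => e (z.1, z.1 + z.2 * (R - 2 * z.1)) * (R - 2 * z.1) with hq
  have hqc : ContDiff ℝ 1 q := by
    have : ContDiff ℝ 1 fun z : ℝ × ℝ => e (z.1, z.1 + z.2 * (R - 2 * z.1)) :=
      hec.comp (by fun_prop)
    exact this.mul (by fun_prop)
  refine ⟨_, hasDerivAt_integral_of_contDiff_one hqc t, ?_⟩
  intro ht htR c h hc hFh
  set L := R - 2 * t with hL
  have hLpos : 0 < L := by simp only [hL]; linarith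
  have hxt : ∀ θ, HasDerivAt (fun s : ℝ => s + θ * (R - 2 * s)) (1 - 2 * θ) t := by
    intro θ
    have := (hasDerivAt_id t).add ((((hasDerivAt_id t).const_mul 2).const_sub R).const_mul θ)
    refine this.congr_deriv (by ring)
  have hxθ : ∀ θ, HasDerivAt (fun θ : ℝ => t + θ * L) L θ := by
    intro θ
    have := ((hasDerivAt_id θ).mul_const L).const_add t
    exact this.congr_deriv (by ring)
  have hqt : ∀ θ, fderiv ℝ q (t, θ) (1, 0) =
      (partialT e (t, t + θ * L) + (1 - 2 * θ) * partialR e (t, t + θ * L)) * L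
        - 2 * e (t, t + θ * L) := by
    intro θ
    have h1 := hasDerivAt_partialT_left hqc t θ
    have h2 := (hasDerivAt_comp_curve hec (hasDerivAt_id t) (hxt θ)).mul
      (((hasDerivAt_id t).const_mul 2).const_sub R)
    refine (h1.unique h2).trans ?_
    simp only [partialT, partialR, hL, id]
    ring
  set M : ℝ × ℝ → ℝ := fun z => 2 * (partialT v z * partialR v z) * z.2 ^ 5 with hM
  have hvt := contDiff_partialT hv
  have hvr := contDiff_partialR hv
  have hMc : ContDiff ℝ 1 M := by
    simp only [hM]
    fun_prop
  have hMr : ∀ r, partialR M (t, r) =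
      2 * (partialR (partialT v) (t, r) * partialR v (t, r)
        + partialT v (t, r) * partialR (partialR v) (t, r)) * r ^ 5
      + 2 * (partialT v (t, r) * partialR v (t, r)) * (5 * r ^ 4) := by
    intro r
    refine (hasDerivAt_partialR_right hMc t r).unique ?_
    have a := hasDerivAt_partialR_right hvt t r
    have b := hasDerivAt_partialR_right hvr t r
    have := ((a.mul b).const_mul 2).mul ((hasDerivAt_id r).pow 5)
    refine this.congr_deriv ?_
    simp
  set N : ℝ → ℝ := fun θ => M (t, t + θ * L) + (1 - 2 * θ) * e (t, t + θ * L) with hN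
  have hNd : ∀ θ, HasDerivAt N (L * partialR M (t, t + θ * L)
      + ((1 - 2 * θ) * (L * partialR e (t, t + θ * L)) - 2 * e (t, t + θ * L))) θ := by
    intro θ
    have h1 := hasDerivAt_comp_curve hMc (hasDerivAt_const θ t) (hxθ θ)
    have h2 := hasDerivAt_comp_curve hec (hasDerivAt_const θ t) (hxθ θ)
    have h3 := ((hasDerivAt_id θ).const_mul 2).const_sub 1
    refine (h1.add (h3.mul h2)).congr_deriv ?_
    simp only [partialR, id]
    ring
  have cM := continuous_partialR hMc
  have ceT := continuous_partialT hec
  have ceR := continuous_partialR hec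
  have ce := hec.continuous
  have cNd : Continuous fun θ => L * partialR M (t, t + θ * L)
      + ((1 - 2 * θ) * (L * partialR e (t, t + θ * L)) - 2 * e (t, t + θ * L)) := by fun_prop
  have hNint : ∫ θ in (0 : ℝ)..1, (L * partialR M (t, t + θ * L)
      + ((1 - 2 * θ) * (L * partialR e (t, t + θ * L)) - 2 * e (t, t + θ * L))) = N 1 - N 0 :=
    intervalIntegral.integral_eq_sub_of_hasDerivAt (fun θ _ => hNd θ)
      (cNd.intervalIntegrable _ _)
  have hMe : ∀ r, 0 ≤ r → |M (t, r)| ≤ e (t, r) := by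
    intro r hr
    simp only [hM, he, radDensity]
    rw [abs_mul, abs_of_nonneg (by positivity : 0 ≤ r ^ 5)]
    refine mul_le_mul_of_nonneg_right ?_ (by positivity)
    have : 0 ≤ p t ^ 2 * v (t, r) ^ 2 := by positivity
    rw [abs_le]
    constructor <;>
      nlinarith [sq_nonneg (partialT v (t, r) - partialR v (t, r)),
        sq_nonneg (partialT v (t, r) + partialR v (t, r))]
  have hNle : N 1 - N 0 ≤ 0 := by
    have h0 := abs_le.1 (hMe t ht.le)
    have h1 := abs_le.1 (hMe (t + L) (by linarith))
    simp only [hN, one_mul, zero_mul, add_zero, mul_zero, sub_zero]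
    linarith [h0.1, h1.2]
  have hFc := hF t
  have key : ∫ θ in (0 : ℝ)..1, fderiv ℝ q (t, θ) (1, 0) ≤
      ∫ θ in (0 : ℝ)..1, ((L * partialR M (t, t + θ * L)
      + ((1 - 2 * θ) * (L * partialR e (t, t + θ * L)) - 2 * e (t, t + θ * L)))
      + ((2 * p t + 1 / c) * (e (t, t + θ * L) * L)
        + c * (L * (F t (t + θ * L) ^ 2 * (t + θ * L) ^ 5)))) := by
    refine intervalIntegral.integral_mono_on zero_le_one ?_ ?_ ?_
    · exact (continuous_partialT hqc |>.comp (by fun_prop : Continuous fun θ : ℝ => (t, θ))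
        ).intervalIntegrable _ _
    · exact Continuous.intervalIntegrable (by fun_prop) _ _
    · intro θ hθ
      rw [hqt θ]
      have hr : 0 < t + θ * L := by have := mul_nonneg hθ.1 hLpos.le; linarith
      have h1 := flux_pointwise (abt := partialR (partialT v) (t, t + θ * L))
        (a := partialT v (t, t + θ * L)) hr (hp0 t) (hp' t ht.le)
        (hVp t (t + θ * L) ht.le (by have := mul_nonneg hθ.1 hLpos.le; linarith)) hc
        (hpde t (t + θ * L) hr)
      rw [← hMr, ← partialT_radDensity hp1 hp hv, ← he] at h1
      have h2 := mul_le_mul_of_nonneg_right h1 hLpos.le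
      have h3 : e (t, t + θ * L) = (partialT v (t, t + θ * L) ^ 2
        + partialR v (t, t + θ * L) ^ 2 + p t ^ 2 * v (t, t + θ * L) ^ 2) * (t + θ * L) ^ 5 := rfl
      have h4 : (2 * p t + 1 / c) * (e (t, t + θ * L) * L)
        + c * (L * (F t (t + θ * L) ^ 2 * (t + θ * L) ^ 5)) =
        ((2 * p t + 1 / c) * (partialT v (t, t + θ * L) ^ 2
        + partialR v (t, t + θ * L) ^ 2 + p t ^ 2 * v (t, t + θ * L) ^ 2)
        + c * F t (t + θ * L) ^ 2) * (t + θ * L) ^ 5 * L := by rw [h3]; ring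
      rw [h4]
      linarith
  refine key.trans ?_
  rw [intervalIntegral.integral_add (cNd.intervalIntegrable _ _)
    (Continuous.intervalIntegrable (by fun_prop) _ _), hNint,
    intervalIntegral.integral_add (Continuous.intervalIntegrable (by fun_prop) _ _)
    (Continuous.intervalIntegrable (by fun_prop) _ _), intervalIntegral.integral_const_mul,
    intervalIntegral.integral_const_mul, intervalIntegral.integral_const_mul]
  have hsub : L * ∫ θ in (0 : ℝ)..1, F t (t + θ * L) ^ 2 * (t + θ * L) ^ 5 =
      ∫ r in t..(R - t), F t r ^ 2 * r ^ 5 := by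
    have := intervalIntegral.mul_integral_comp_add_mul (a := 0) (b := 1) (c := L) (d := t)
      (f := fun r => F t r ^ 2 * r ^ 5)
    simp only [mul_comm _ L]
    rw [this]
    congr 1 <;> simp only [hL] <;> ring
  rw [hsub]
  have : c * (∫ r in t..(R - t), F t r ^ 2 * r ^ 5) ≤ c * h ^ 2 := by gcongr
  have e2 : coneEnergy p v R t = ∫ θ in (0 : ℝ)..1, e (t, t + θ * L) * L := rfl
  rw [e2]
  linarith

lemma coneEnergy_eq_integral (p : ℝ → ℝ) (v : ℝ × ℝ → ℝ) (R t : ℝ) :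
    coneEnergy p v R t = ∫ r in t..(R - t), radDensity p v (t, r) := by
  have := intervalIntegral.mul_integral_comp_add_mul (a := 0) (b := 1) (c := R - 2 * t) (d := t)
    (f := fun r => radDensity p v (t, r))
  rw [coneEnergy, intervalIntegral.integral_mul_const, mul_comm]
  simp only [mul_comm _ (R - 2 * t)]
  rw [this]
  congr 1 <;> ring

lemma coneEnergy_zero {p : ℝ → ℝ} {v : ℝ × ℝ → ℝ} (hv : ContDiff ℝ 2 v)
    (hv0 : ∀ r, v (0, r) = 0) (hv1 : ∀ r, partialT v (0, r) = 0) (R : ℝ) :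
    coneEnergy p v R 0 = 0 := by
  have hr : ∀ r, partialR v (0, r) = 0 := fun r => by
    have := hasDerivAt_partialR_right (hv.of_le (by norm_num : (1 : WithTop ℕ∞) ≤ 2)) 0 r
    simp only [hv0] at this
    exact this.unique (hasDerivAt_const r 0)
  simp [coneEnergy, radDensity, hv0, hv1, hr]

theorem cone_energy_bound {p p' A H h : ℝ → ℝ} {K : ℝ} {v : ℝ × ℝ → ℝ} {V : ℝ → ℝ}
    {F : ℝ → ℝ → ℝ}
    (hp1 : ContDiff ℝ 1 p) (hp : ∀ t, HasDerivAt p (p' t) t) (hp0 : ∀ t, 0 ≤ p t)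
    (hp' : ∀ t, 0 ≤ t → p' t ≤ 0) (hVp : ∀ t r, 0 ≤ t → t ≤ r → |V r| ≤ p t ^ 2)
    (hA : ∀ t, HasDerivAt A (p t) t) (hA0 : A 0 = 0) (hAK : ∀ t, A t ≤ K)
    (hH : ∀ t, 0 ≤ t → HasDerivAt H (h t) t) (hh : ∀ t, 0 ≤ t → 0 ≤ h t) (hH0 : 0 ≤ H 0)
    (hv : ContDiff ℝ 2 v) (hv0 : ∀ r, v (0, r) = 0) (hv1 : ∀ r, partialT v (0, r) = 0)
    (hpde : ∀ t r, 0 < r → partialT (partialT v) (t, r) - partialR (partialR v) (t, r)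
      - 5 / r * partialR v (t, r) + V r * v (t, r) = F t r)
    (hF : ∀ t, Continuous (F t))
    (hFh : ∀ t b, 0 < t → t ≤ b → (∫ r in t..b, F t r ^ 2 * r ^ 5) ≤ h t ^ 2)
    {T b : ℝ} (hT : 0 ≤ T) (hb : T < b) :
    (∫ r in T..b, (partialT v (T, r) ^ 2 + partialR v (T, r) ^ 2) * r ^ 5) ≤
      exp (2 * K) * H T ^ 2 := by
  set R := b + T with hR
  set E := coneEnergy p v R with hE
  have hcE : ∀ t, ∃ E', HasDerivAt E E' t ∧ _ := fun t =>
    hasDerivAt_coneEnergy hp1 hp hp0 hp' hVp hv hpde hF R t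
  choose E' hE' hE'' using hcE
  have hA0' : ∀ t, 0 ≤ t → 0 ≤ A t := by
    intro t ht
    have : Monotone A := monotone_of_deriv_nonneg (fun t => (hA t).differentiableAt)
      fun t => by rw [(hA t).deriv]; exact hp0 t
    rw [← hA0]; exact this ht
  have hHT : ∀ t, 0 ≤ t → 0 ≤ H t := by
    intro t ht
    have : MonotoneOn H (Ici 0) := monotoneOn_of_deriv_nonneg (convex_Ici 0)
      (fun t ht => (hH t ht).continuousAt.continuousWithinAt)
      (fun t ht => (hH t (interior_subset ht)).differentiableAt.differentiableWithinAt)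
      fun t ht => by rw [(hH t (interior_subset ht)).deriv]; exact hh t (interior_subset ht)
    exact hH0.trans (this self_mem_Ici ht ht)
  have hET : ∀ δ > 0, E T ≤ exp (2 * K) * ((H T + δ * T) * (H T + δ * (1 + T))) := by
    intro δ hδ
    have hpos : ∀ t, 0 ≤ t → 0 < H t + δ * (1 + t) := fun t ht => by
      have := hHT t ht; positivity
    set y : ℝ → ℝ := fun t => E t * exp (-(2 * A t)) / (H t + δ * (1 + t)) - (H t + δ * t) with hy
    have hyd : ∀ t, 0 ≤ t → HasDerivAt y
        (((E' t * exp (-(2 * A t)) + E t * (exp (-(2 * A t)) * -(2 * p t)))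
          * (H t + δ * (1 + t)) - E t * exp (-(2 * A t)) * (h t + δ)) / (H t + δ * (1 + t)) ^ 2
          - (h t + δ)) t := by
      intro t ht
      have h1 := (hE' t).mul (((hA t).const_mul 2).neg.exp)
      have h2 := (hH t ht).add (((hasDerivAt_id t).const_add 1).const_mul δ)
      have h3 := (hH t ht).add ((hasDerivAt_id t).const_mul δ)
      refine ((h1.div h2 (hpos t ht).ne').sub h3).congr_deriv ?_
      simp
    have hanti : AntitoneOn y (Icc 0 T) := by
      refine antitoneOn_of_deriv_nonpos (convex_Icc 0 T)
        (fun t ht => (hyd t ht.1).continuousAt.continuousWithinAt)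
        (fun t ht => (hyd t (interior_subset ht).1).differentiableAt.differentiableWithinAt) ?_
      intro t ht
      rw [interior_Icc] at ht
      rw [(hyd t ht.1.le).deriv]
      have hk := hpos t ht.1.le
      have hhk : 0 < h t + δ := by have := hh t ht.1.le; linarith
      have hb1 := hE'' t ht.1 (by simp only [hR]; linarith [ht.2])
        ((H t + δ * (1 + t)) / (h t + δ)) (h t) (by positivity)
        (hFh t (R - t) ht.1 (by simp only [hR]; linarith [ht.2]))
      set k := H t + δ * (1 + t) with hk'
      set x := exp (-(2 * A t)) with hx
      have hx1 : x ≤ 1 := by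
        rw [hx, exp_le_one_iff]
        have := hA0' t ht.1.le
        linarith
      have hx0 : 0 < x := exp_pos _
      have hb2 : (E' t - 2 * p t * E t) * k - E t * (h t + δ) ≤ k ^ 2 * (h t + δ) := by
        have e1 : (E' t - 2 * p t * E t) * k ≤
            (1 / (k / (h t + δ)) * E t + k / (h t + δ) * h t ^ 2) * k := by
          refine mul_le_mul_of_nonneg_right ?_ hk.le
          linarith
        have e2 : (1 / (k / (h t + δ)) * E t + k / (h t + δ) * h t ^ 2) * k =
            E t * (h t + δ) + k ^ 2 * (h t ^ 2 / (h t + δ)) := by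
          field_simp
        have e3 : h t ^ 2 / (h t + δ) ≤ h t + δ := by
          rw [div_le_iff₀ hhk]
          have := hh t ht.1.le
          nlinarith
        have e4 : k ^ 2 * (h t ^ 2 / (h t + δ)) ≤ k ^ 2 * (h t + δ) := by gcongr
        linarith
      rw [sub_nonpos, div_le_iff₀ (by positivity)]
      have e5 : (E' t * x + E t * (x * -(2 * p t))) * k - E t * x * (h t + δ) =
          x * ((E' t - 2 * p t * E t) * k - E t * (h t + δ)) := by ring
      rw [e5]
      calc _ ≤ x * (k ^ 2 * (h t + δ)) := by gcongr
        _ ≤ 1 * (k ^ 2 * (h t + δ)) := by gcongr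
        _ = _ := by ring
    have hyT := hanti ⟨le_rfl, hT⟩ ⟨hT, le_rfl⟩ hT
    have hy0 : y 0 ≤ 0 := by
      simp only [hy, hE, coneEnergy_zero hv hv0 hv1]
      simpa using hH0
    have hyT' : E T * exp (-(2 * A T)) / (H T + δ * (1 + T)) ≤ H T + δ * T := by
      have := hyT.trans hy0
      simp only [hy] at this
      linarith
    rw [div_le_iff₀ (hpos T hT), exp_neg, ← div_eq_mul_inv, div_le_iff₀ (exp_pos _)] at hyT'
    refine hyT'.trans ?_
    rw [mul_comm (exp (2 * K))]
    have := hHT T hT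
    have := hAK T
    gcongr
  have hlim : E T ≤ exp (2 * K) * H T ^ 2 := by
    have hc : Tendsto (fun δ : ℝ => exp (2 * K) * ((H T + δ * T) * (H T + δ * (1 + T))))
        (𝓝[>] 0) (𝓝 (exp (2 * K) * ((H T + 0 * T) * (H T + 0 * (1 + T))))) :=
      (Continuous.tendsto (by fun_prop) 0).mono_left nhdsWithin_le_nhds
    have := ge_of_tendsto hc (eventually_mem_nhdsWithin.mono fun δ hδ => hET δ hδ)
    simpa [sq] using this
  refine le_trans ?_ hlim
  rw [hE, coneEnergy_eq_integral]
  have e : R - T = b := by simp [hR]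
  rw [e]
  have c1 := (contDiff_partialT hv).continuous
  have c2 := (contDiff_partialR hv).continuous
  have c3 := (contDiff_radDensity hp1 hv).continuous
  refine intervalIntegral.integral_mono_on hb.le
    (Continuous.intervalIntegrable (by fun_prop) _ _)
    (Continuous.intervalIntegrable (by fun_prop) _ _) ?_
  intro r hr
  unfold radDensity
  have : 0 ≤ r := hT.trans hr.1
  have : 0 ≤ p T ^ 2 * v (T, r) ^ 2 := by positivity
  exact mul_le_mul_of_nonneg_right (by linarith) (by positivity)

/-- The radial profile of the rescaled ground state `W_{(a)}`. -/
def solitonProfile (a r : ℝ) : ℝ := 576 * a ^ 2 / (24 * a ^ 2 + r ^ 2) ^ 2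

/-- The radial profile of `(ΛW)_{(a)}`. -/
def resonanceProfile (a r : ℝ) : ℝ :=
  1152 * a ^ 2 * (24 * a ^ 2 - r ^ 2) / (24 * a ^ 2 + r ^ 2) ^ 3

/-- The derivative of `resonanceProfile a`. -/
def resonanceProfileDeriv (a r : ℝ) : ℝ :=
  1152 * a ^ 2 * (4 * r ^ 3 - 192 * a ^ 2 * r) / (24 * a ^ 2 + r ^ 2) ^ 4

/-- The second derivative of `resonanceProfile a`. -/
def resonanceProfileDeriv₂ (a r : ℝ) : ℝ :=
  1152 * a ^ 2 * ((12 * r ^ 2 - 192 * a ^ 2) * (24 * a ^ 2 + r ^ 2)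
    - 8 * r * (4 * r ^ 3 - 192 * a ^ 2 * r)) / (24 * a ^ 2 + r ^ 2) ^ 5

lemma solitonProfile_nonneg (a r : ℝ) : 0 ≤ solitonProfile a r := by
  unfold solitonProfile; positivity

lemma continuous_solitonProfile {a : ℝ} (ha : 0 < a) : Continuous (solitonProfile a) := by
  unfold solitonProfile
  exact continuous_const.div (by fun_prop) fun r => by positivity

lemma contDiff_resonanceProfile {a : ℝ} (ha : 0 < a) : ContDiff ℝ 2 (resonanceProfile a) := by
  unfold resonanceProfile
  exact ContDiff.div (by fun_prop) (by fun_prop) fun r => by positivity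

lemma solitonProfile_anti {a t r : ℝ} (ha : 0 < a) (ht : 0 ≤ t) (htr : t ≤ r) :
    solitonProfile a r ≤ solitonProfile a t := by
  unfold solitonProfile; gcongr

lemma abs_resonanceProfile_le {a : ℝ} (ha : 0 < a) (r : ℝ) :
    |resonanceProfile a r| ≤ 2 * solitonProfile a r := by
  have h : |24 * a ^ 2 - r ^ 2| ≤ 24 * a ^ 2 + r ^ 2 := by
    rw [abs_le]; constructor <;> nlinarith [sq_nonneg a, sq_nonneg r]
  have hp : 0 < 24 * a ^ 2 + r ^ 2 := by positivity
  rw [resonanceProfile, solitonProfile, abs_div, abs_mul, abs_of_pos (pow_pos hp 3),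
    abs_of_pos (by positivity : 0 < 1152 * a ^ 2), div_le_iff₀ (pow_pos hp 3)]
  calc 1152 * a ^ 2 * |24 * a ^ 2 - r ^ 2| ≤ 1152 * a ^ 2 * (24 * a ^ 2 + r ^ 2) := by gcongr
    _ = _ := by field_simp; ring

lemma hasDerivAt_resonanceProfile {a : ℝ} (ha : 0 < a) (r : ℝ) :
    HasDerivAt (resonanceProfile a) (resonanceProfileDeriv a r) r := by
  have hp : 0 < 24 * a ^ 2 + r ^ 2 := by positivity
  have h1 := (((hasDerivAt_id r).pow 2).const_sub (24 * a ^ 2)).const_mul (1152 * a ^ 2)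
  have h2 := (((hasDerivAt_id r).pow 2).const_add (24 * a ^ 2)).pow 3
  refine (h1.div h2 (by simpa using (pow_pos hp 3).ne')).congr_deriv ?_
  simp [resonanceProfileDeriv]
  field_simp
  ring

lemma hasDerivAt_resonanceProfileDeriv {a : ℝ} (ha : 0 < a) (r : ℝ) :
    HasDerivAt (resonanceProfileDeriv a) (resonanceProfileDeriv₂ a r) r := by
  have hp : 0 < 24 * a ^ 2 + r ^ 2 := by positivity
  have h1 := ((((hasDerivAt_id r).pow 3).const_mul 4).sub
    ((hasDerivAt_id r).const_mul (192 * a ^ 2))).const_mul (1152 * a ^ 2)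
  have h2 := (((hasDerivAt_id r).pow 2).const_add (24 * a ^ 2)).pow 4
  refine (h1.div h2 (by simpa using (pow_pos hp 4).ne')).congr_deriv ?_
  simp [resonanceProfileDeriv₂]
  field_simp
  ring

lemma resonanceProfile_ode {a r : ℝ} (ha : 0 < a) (hr : 0 < r) :
    resonanceProfileDeriv₂ a r + 5 / r * resonanceProfileDeriv a r =
      -2 * solitonProfile a r * resonanceProfile a r := by
  have hp : 0 < 24 * a ^ 2 + r ^ 2 := by positivity
  unfold resonanceProfileDeriv₂ resonanceProfileDeriv solitonProfile resonanceProfile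
  field_simp
  ring

lemma integral_source_sq_le {a b t c : ℝ} (ha : 0 < a) (hb : 0 < b) (ht : 0 < t) (htc : t ≤ c) :
    (∫ r in t..c, (4 * solitonProfile a r * solitonProfile b r) ^ 2 * r ^ 5) ≤
      (1327104 * a ^ 2 * b ^ 2 / ((a + t) * (b ^ 2 + t ^ 2) ^ 2)) ^ 2 := by
  have cA := continuous_solitonProfile ha
  have cB := continuous_solitonProfile hb
  set M := 1327104 ^ 2 * a ^ 4 * b ^ 4 / (b ^ 2 + t ^ 2) ^ 4 with hM
  have hcont : Continuous fun r : ℝ => r / (a ^ 2 + r ^ 2) ^ 2 :=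
    continuous_id.div (by fun_prop) fun r => by positivity
  have h1 : (∫ r in t..c, (4 * solitonProfile a r * solitonProfile b r) ^ 2 * r ^ 5) ≤
      ∫ r in t..c, M * (r / (a ^ 2 + r ^ 2) ^ 2) := by
    refine intervalIntegral.integral_mono_on htc
      (Continuous.intervalIntegrable (by fun_prop) _ _)
      ((hcont.const_mul M).intervalIntegrable _ _) ?_
    intro r hr
    have hr0 : 0 < r := ht.trans_le hr.1
    have e1 : (4 * solitonProfile a r * solitonProfile b r) ^ 2 * r ^ 5 =
        1327104 ^ 2 * a ^ 4 * b ^ 4 * ((r ^ 2) ^ 2 * r) /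
          ((24 * a ^ 2 + r ^ 2) ^ 2 * (24 * a ^ 2 + r ^ 2) ^ 2 * (24 * b ^ 2 + r ^ 2) ^ 4) := by
      unfold solitonProfile; field_simp; norm_num
    have e2 : M * (r / (a ^ 2 + r ^ 2) ^ 2) = 1327104 ^ 2 * a ^ 4 * b ^ 4 * ((r ^ 2) ^ 2 * r) /
          ((r ^ 2) ^ 2 * (a ^ 2 + r ^ 2) ^ 2 * (b ^ 2 + t ^ 2) ^ 4) := by
      rw [hM]; field_simp
    rw [e1, e2]
    have : t ≤ r := hr.1
    gcongr
    · nlinarith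
    · nlinarith
    · nlinarith
  have h2 : (∫ r in t..c, r / (a ^ 2 + r ^ 2) ^ 2) =
      -(1 / (2 * (a ^ 2 + c ^ 2))) - -(1 / (2 * (a ^ 2 + t ^ 2))) := by
    refine intervalIntegral.integral_eq_sub_of_hasDerivAt
      (f := fun r => -(1 / (2 * (a ^ 2 + r ^ 2)))) ?_ (hcont.intervalIntegrable _ _)
    intro r _
    have hp : 0 < a ^ 2 + r ^ 2 := by positivity
    have h := ((((hasDerivAt_id r).pow 2).const_add (a ^ 2)).const_mul 2)
    have := ((hasDerivAt_const r (1 : ℝ)).div h (by simp; positivity)).neg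
    refine this.congr_deriv ?_
    simp
    field_simp
  have h3 : -(1 / (2 * (a ^ 2 + c ^ 2))) - -(1 / (2 * (a ^ 2 + t ^ 2))) ≤ 1 / (a + t) ^ 2 := by
    have p1 : 0 < 1 / (2 * (a ^ 2 + c ^ 2)) := by positivity
    have p2 : 1 / (2 * (a ^ 2 + t ^ 2)) ≤ 1 / (a + t) ^ 2 := by
      gcongr
      nlinarith [sq_nonneg (a - t)]
    linarith
  rw [intervalIntegral.integral_const_mul, h2] at h1
  refine h1.trans ?_
  calc _ ≤ M * (1 / (a + t) ^ 2) := by gcongr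
    _ = _ := by rw [hM]; field_simp

lemma source_static_bound {a b t : ℝ} (ha : 0 < a) (hb : 0 < b) (ht : 0 ≤ t) :
    1327104 * a ^ 2 * b ^ 2 / ((a + t) * (b ^ 2 + t ^ 2) ^ 2) ≤
      2654208 * a ^ 2 / b / ((a + t) * (b + t)) := by
  have e : 2654208 * a ^ 2 / b / ((a + t) * (b + t)) =
      1327104 * a ^ 2 * b ^ 2 / ((a + t) * (b ^ 2 * (b * (b + t) / 2))) := by
    field_simp; norm_num
  rw [e]
  gcongr
  rw [sq (b ^ 2 + t ^ 2)]
  gcongr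
  · nlinarith
  · nlinarith [sq_nonneg (b - t), sq_nonneg (b - 2 * t)]

lemma source_linear_bound {a b d t : ℝ} (ha : 0 < a) (hb : 0 < b) (had : a ≤ d) (ht : 0 ≤ t) :
    t / d * (1327104 * a ^ 2 * b ^ 2 / ((a + t) * (b ^ 2 + t ^ 2) ^ 2)) ≤
      1327104 * a / (b ^ 2 + t ^ 2) := by
  have hd := ha.trans_le had
  calc _ ≤ t / a * (1327104 * a ^ 2 * b ^ 2 / ((a + t) * (b ^ 2 + t ^ 2) ^ 2)) := by gcongr
    _ = (t / (a + t)) * (b ^ 2 / (b ^ 2 + t ^ 2)) * (1327104 * a / (b ^ 2 + t ^ 2)) := by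
      field_simp
    _ ≤ 1 * 1 * (1327104 * a / (b ^ 2 + t ^ 2)) := by
      gcongr
      · rw [div_le_one (by positivity)]; linarith
      · rw [div_le_one (by positivity)]; nlinarith
    _ = _ := by ring

lemma hasDerivAt_linear_primitive {b : ℝ} (hb : 0 < b) (a t : ℝ) :
    HasDerivAt (fun t => 1327104 * (a / b) * arctan (t / b)) (1327104 * a / (b ^ 2 + t ^ 2)) t := by
  refine (((hasDerivAt_id t).div_const b).arctan.const_mul (1327104 * (a / b))).congr_deriv ?_
  simp
  field_simp

lemma hasDerivAt_static_primitive {a b t : ℝ} (ha : 0 < a) (hab : a < b) (ht : 0 ≤ t) :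
    HasDerivAt
      (fun t => 2654208 * a ^ 2 / (b * (b - a)) *
        (Real.log ((a + t) / (b + t)) - Real.log (a / b)))
      (2654208 * a ^ 2 / b / ((a + t) * (b + t))) t := by
  have h1 : 0 < a + t := by positivity
  have h2 : 0 < b + t := by linarith
  have h3 : 0 < b - a := by linarith
  have hb : 0 < b := by linarith
  have h := (((hasDerivAt_id t).const_add a).div ((hasDerivAt_id t).const_add b) h2.ne').log
    (by simp; constructor <;> positivity)
  refine ((h.sub_const (Real.log (a / b))).const_mul _).congr_deriv ?_
  simp
  field_simp

lemma sq_mul_neg_log_le {x y : ℝ} (hx : 0 < x) (hxy : x ≤ y) (hy : y ≤ 1 / 4) :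
    x ^ 2 * -Real.log x ≤ y ^ 2 * |Real.log y| := by
  have hy0 : 0 < y := hx.trans_le hxy
  have hl : Real.log y ≤ -(1 / 2) := by
    have := log_le_sub_one_of_pos (show 0 < y * 2 by positivity)
    have e := log_mul hy0.ne' two_ne_zero
    have := Real.log_two_gt_d9
    linarith
  rw [abs_of_nonpos (by linarith)]
  have h1 : Real.log (y / x) ≤ ((y / x) ^ 2 - 1) / 2 := by
    have := log_le_sub_one_of_pos (show 0 < (y / x) ^ 2 by positivity)
    rw [Real.log_pow] at this
    push_cast at this
    linarith
  have h2 : Real.log x = Real.log y - Real.log (y / x) := by rw [log_div hy0.ne' hx.ne']; ring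
  have h3 : 1 ≤ (y / x) ^ 2 := one_le_pow₀ ((one_le_div hx).2 hxy)
  have h4 : Real.log (y / x) ≤ ((y / x) ^ 2 - 1) * -Real.log y := by nlinarith
  have h5 : -Real.log x ≤ (y / x) ^ 2 * -Real.log y := by rw [h2]; linarith
  calc x ^ 2 * -Real.log x ≤ x ^ 2 * ((y / x) ^ 2 * -Real.log y) := by gcongr
    _ = _ := by field_simp

lemma static_primitive_le {a b t g : ℝ} (ha : 0 < a) (hab : a / b ≤ g) (hb : 0 < b)
    (hg : g ≤ 1 / 4) (ht : 0 ≤ t) :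
    2654208 * a ^ 2 / (b * (b - a)) * (Real.log ((a + t) / (b + t)) - Real.log (a / b)) ≤
      5308416 * (g ^ 2 * |Real.log g|) := by
  have hx : 0 < a / b := by positivity
  have hab4 : a ≤ b / 4 := by
    have := hab.trans hg
    rw [div_le_iff₀ hb] at this
    linarith
  have hba : b / 2 ≤ b - a := by linarith
  have hl : Real.log ((a + t) / (b + t)) ≤ 0 :=
    log_nonpos (by positivity) ((div_le_one (by positivity)).2 (by linarith))
  have hl2 : 0 ≤ -Real.log (a / b) :=
    neg_nonneg.2 (log_nonpos hx.le (by linarith))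
  have hba0 : 0 < b - a := by linarith
  calc _ ≤ 2654208 * a ^ 2 / (b * (b - a)) * -Real.log (a / b) := by gcongr; linarith
    _ ≤ 2654208 * a ^ 2 / (b * (b / 2)) * -Real.log (a / b) := by gcongr
    _ = 5308416 * ((a / b) ^ 2 * -Real.log (a / b)) := by field_simp; ring
    _ ≤ _ := mul_le_mul_of_nonneg_left (sq_mul_neg_log_le hx hab hg) (by norm_num)

lemma solitonProfile_le_sq {a t : ℝ} (ha : 0 < a) :
    2 * solitonProfile a t ≤ (36 * a / (16 * a ^ 2 + t ^ 2)) ^ 2 := by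
  have : (36 * a / (16 * a ^ 2 + t ^ 2)) ^ 2 = 1296 * a ^ 2 / (16 * a ^ 2 + t ^ 2) ^ 2 := by
    rw [div_pow]; ring
  rw [this, solitonProfile, ← mul_div_assoc]
  gcongr ?_ / (?_ + _) ^ 2
  · nlinarith [sq_nonneg a]
  · nlinarith [sq_nonneg a]

theorem multisoliton_cone_bound {J : ℕ} {lam : Fin J → ℝ} (hlam : ∀ k, 0 < lam k) (j : Fin J)
    {s : ℝ → ℝ} {h H : Fin J → ℝ → ℝ} {B : ℝ} (hB : 0 ≤ B)
    (hs : ∀ k, k ≠ j → ∀ t, 0 ≤ t → |s t| * (1327104 * min (lam k) (lam j) ^ 2 *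
      max (lam k) (lam j) ^ 2 / ((min (lam k) (lam j) + t) *
        (max (lam k) (lam j) ^ 2 + t ^ 2) ^ 2)) ≤ h k t)
    (hH : ∀ k, k ≠ j → ∀ t, 0 ≤ t → HasDerivAt (H k) (h k t) t)
    (hH0 : ∀ k, k ≠ j → 0 ≤ H k 0) (hHB : ∀ k, k ≠ j → ∀ t, 0 ≤ t → H k t ≤ B)
    {v : ℝ × ℝ → ℝ} (hv : ContDiff ℝ 2 v) (hv0 : ∀ r, v (0, r) = 0)
    (hv1 : ∀ r, partialT v (0, r) = 0)
    (hpde : ∀ t r, 0 < r → partialT (partialT v) (t, r) - partialR (partialR v) (t, r)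
      - 5 / r * partialR v (t, r) + (∑ k, -2 * solitonProfile (lam k) r) * v (t, r) =
      s t * ∑ k ∈ Finset.univ.erase j,
        2 * solitonProfile (lam k) r * resonanceProfile (lam j) r)
    {T b : ℝ} (hT : 0 ≤ T) (hb : T < b) :
    (∫ r in T..b, (partialT v (T, r) ^ 2 + partialR v (T, r) ^ 2) * r ^ 5) ≤
      exp (2 * (18 * J)) * (J * (J * B)) ^ 2 := by
  set p : ℝ → ℝ := fun t => ∑ k, 36 * lam k / (16 * lam k ^ 2 + t ^ 2) with hp
  set p' : ℝ → ℝ := fun t => ∑ k, -(36 * lam k * (2 * t)) / (16 * lam k ^ 2 + t ^ 2) ^ 2 with hp'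
  set A : ℝ → ℝ := fun t => ∑ k, 9 * arctan (t / (4 * lam k)) with hA
  set S := Finset.univ.erase j with hS
  have hSj : ∀ k ∈ S, k ≠ j := fun k hk => Finset.ne_of_mem_erase hk
  have hScard : (S.card : ℝ) ≤ J := by
    have := Finset.card_le_univ S
    rw [Fintype.card_fin] at this
    exact_mod_cast this
  have hh0 : ∀ k ∈ S, ∀ t, 0 ≤ t → 0 ≤ h k t := by
    intro k hk t ht
    refine le_trans ?_ (hs k (hSj k hk) t ht)
    have := hlam k
    have := hlam j
    have : 0 < min (lam k) (lam j) := lt_min (hlam k) (hlam j)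
    positivity
  have hden : ∀ k t, 0 < 16 * lam k ^ 2 + t ^ 2 := fun k t => by
    have := hlam k; positivity
  have hterm : ∀ k t, 0 ≤ 36 * lam k / (16 * lam k ^ 2 + t ^ 2) := fun k t => by
    have := hlam k; positivity
  have hp1 : ContDiff ℝ 1 p := by
    refine ContDiff.sum fun k _ => ContDiff.div (by fun_prop) (by fun_prop) fun t => (hden k t).ne'
  have hpd : ∀ t, HasDerivAt p (p' t) t := by
    intro t
    refine HasDerivAt.fun_sum fun k _ => ?_
    have h1 := ((hasDerivAt_id t).pow 2).const_add (16 * lam k ^ 2)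
    refine ((hasDerivAt_const t (36 * lam k)).div h1 (by simpa using (hden k t).ne')).congr_deriv ?_
    simp
  have hAd : ∀ t, HasDerivAt A (p t) t := by
    intro t
    refine HasDerivAt.fun_sum fun k _ => ?_
    have := hlam k
    refine (((hasDerivAt_id t).div_const (4 * lam k)).arctan.const_mul 9).congr_deriv ?_
    simp
    field_simp
    ring
  have hAK : ∀ t, A t ≤ 18 * J := by
    intro t
    have : ∀ k ∈ (Finset.univ : Finset (Fin J)), 9 * arctan (t / (4 * lam k)) ≤ 18 := by
      intro k _
      have h1 := arctan_lt_pi_div_two (t / (4 * lam k))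
      have := pi_lt_four
      linarith
    refine (Finset.sum_le_sum this).trans ?_
    simp [mul_comm]
  have hVp : ∀ t r, 0 ≤ t → t ≤ r → |∑ k, -2 * solitonProfile (lam k) r| ≤ p t ^ 2 := by
    intro t r ht htr
    refine (Finset.abs_sum_le_sum_abs _ _).trans ?_
    refine le_trans (Finset.sum_le_sum fun k _ => ?_)
      (Finset.sum_sq_le_sq_sum_of_nonneg fun k _ => hterm k t)
    rw [abs_mul, abs_of_nonneg (solitonProfile_nonneg _ _)]
    norm_num
    refine le_trans ?_ (solitonProfile_le_sq (hlam k))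
    have := solitonProfile_anti (hlam k) ht htr
    linarith
  have hVpos : ∀ t, 0 ≤ p t := fun t => Finset.sum_nonneg fun k _ => hterm k t
  have hp'n : ∀ t, 0 ≤ t → p' t ≤ 0 := fun t ht => Finset.sum_nonpos fun k _ => by
    have := hlam k
    have := hden k t
    rw [neg_div]
    exact neg_nonpos.2 (by positivity)
  have cw : ∀ k, Continuous (solitonProfile (lam k)) := fun k => continuous_solitonProfile (hlam k)
  have cg : Continuous (resonanceProfile (lam j)) := (contDiff_resonanceProfile (hlam j)).continuous
  have hF : ∀ t, Continuous fun r => s t * ∑ k ∈ S,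
      2 * solitonProfile (lam k) r * resonanceProfile (lam j) r := fun t => by fun_prop
  have hFh : ∀ t c, 0 < t → t ≤ c → (∫ r in t..c, (s t * ∑ k ∈ S,
      2 * solitonProfile (lam k) r * resonanceProfile (lam j) r) ^ 2 * r ^ 5) ≤
      (J * ∑ k ∈ S, h k t) ^ 2 := by
    intro t c ht htc
    have h1 : (∫ r in t..c, (s t * ∑ k ∈ S,
        2 * solitonProfile (lam k) r * resonanceProfile (lam j) r) ^ 2 * r ^ 5) ≤
        ∫ r in t..c, J * s t ^ 2 * ∑ k ∈ S,
          (4 * solitonProfile (lam k) r * solitonProfile (lam j) r) ^ 2 * r ^ 5 := by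
      refine intervalIntegral.integral_mono_on htc
        (Continuous.intervalIntegrable (by fun_prop) _ _)
        (Continuous.intervalIntegrable (by fun_prop) _ _) ?_
      intro r hr
      have hr0 : 0 ≤ r := ht.le.trans hr.1
      have e : ∑ k ∈ S, (4 * solitonProfile (lam k) r * solitonProfile (lam j) r) ^ 2 * r ^ 5 =
          (∑ k ∈ S, (4 * solitonProfile (lam k) r * solitonProfile (lam j) r) ^ 2) * r ^ 5 := by
        rw [Finset.sum_mul]
      rw [e, mul_pow, ← mul_assoc]
      refine mul_le_mul_of_nonneg_right ?_ (by positivity)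
      rw [mul_comm (J : ℝ), mul_assoc]
      refine mul_le_mul_of_nonneg_left ?_ (sq_nonneg _)
      refine sq_sum_le_card_mul_sum_sq.trans ?_
      refine mul_le_mul hScard (Finset.sum_le_sum fun k _ => ?_) (Finset.sum_nonneg fun k _ =>
        sq_nonneg _) (Nat.cast_nonneg _)
      rw [← sq_abs]
      refine pow_le_pow_left₀ (abs_nonneg _) ?_ 2
      rw [abs_mul, abs_of_nonneg (by have := solitonProfile_nonneg (lam k) r; positivity)]
      calc _ ≤ 2 * solitonProfile (lam k) r * (2 * solitonProfile (lam j) r) := by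
            refine mul_le_mul_of_nonneg_left (abs_resonanceProfile_le (hlam j) r) ?_
            have := solitonProfile_nonneg (lam k) r
            positivity
        _ = _ := by ring
    refine h1.trans ?_
    rw [intervalIntegral.integral_const_mul, intervalIntegral.integral_finsetSum fun k _ =>
      Continuous.intervalIntegrable (by fun_prop) _ _]
    have h2 : ∀ k ∈ S, s t ^ 2 * (∫ r in t..c,
        (4 * solitonProfile (lam k) r * solitonProfile (lam j) r) ^ 2 * r ^ 5) ≤ h k t ^ 2 := by
      intro k hk
      have hmin : 0 < min (lam k) (lam j) := lt_min (hlam k) (hlam j)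
      have hmax : 0 < max (lam k) (lam j) := lt_max_of_lt_left (hlam k)
      have e : ∀ r, 4 * solitonProfile (lam k) r * solitonProfile (lam j) r =
          4 * solitonProfile (min (lam k) (lam j)) r * solitonProfile (max (lam k) (lam j)) r := by
        intro r
        rcases le_total (lam k) (lam j) with hkj | hkj
        · rw [min_eq_left hkj, max_eq_right hkj]
        · rw [min_eq_right hkj, max_eq_left hkj]; ring
      simp only [e]
      calc _ ≤ |s t| ^ 2 * (1327104 * min (lam k) (lam j) ^ 2 * max (lam k) (lam j) ^ 2 /
            ((min (lam k) (lam j) + t) * (max (lam k) (lam j) ^ 2 + t ^ 2) ^ 2)) ^ 2 := by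
            rw [sq_abs]
            exact mul_le_mul_of_nonneg_left (integral_source_sq_le hmin hmax ht htc) (sq_nonneg _)
        _ ≤ _ := by
            rw [← mul_pow]
            exact pow_le_pow_left₀ (by positivity) (hs k (hSj k hk) t ht.le) 2
    have hJ1 : (1 : ℝ) ≤ J := by
      have : 0 < J := Fin.pos j
      exact_mod_cast this
    calc _ = (J : ℝ) * ∑ k ∈ S, s t ^ 2 * (∫ r in t..c,
        (4 * solitonProfile (lam k) r * solitonProfile (lam j) r) ^ 2 * r ^ 5) := by
          rw [← Finset.mul_sum, mul_assoc]
      _ ≤ (J : ℝ) * ∑ k ∈ S, h k t ^ 2 := by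
          gcongr with k hk
          exact h2 k hk
      _ ≤ (J : ℝ) ^ 2 * (∑ k ∈ S, h k t) ^ 2 := by
          refine mul_le_mul (by nlinarith) (Finset.sum_sq_le_sq_sum_of_nonneg fun k hk => hh0 k hk t ht.le)
            (Finset.sum_nonneg fun k _ => sq_nonneg _) (by positivity)
      _ = _ := by ring
  have main := cone_energy_bound (H := fun t => J * ∑ k ∈ S, H k t)
    (h := fun t => J * ∑ k ∈ S, h k t) hp1 hpd hVpos hp'n hVp hAd (by simp [hA]) hAK
    (fun t ht => (HasDerivAt.fun_sum fun k hk => hH k (hSj k hk) t ht).const_mul _)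
    (fun t ht => mul_nonneg (Nat.cast_nonneg _) (Finset.sum_nonneg fun k hk => hh0 k hk t ht))
    (mul_nonneg (Nat.cast_nonneg _) (Finset.sum_nonneg fun k hk => hH0 k (hSj k hk)))
    hv hv0 hv1 hpde hF hFh hT hb
  refine main.trans ?_
  have hHnn : ∀ k ∈ S, 0 ≤ H k T := by
    intro k hk
    have : MonotoneOn (H k) (Ici 0) := monotoneOn_of_deriv_nonneg (convex_Ici 0)
      (fun t ht => (hH k (hSj k hk) t ht).continuousAt.continuousWithinAt)
      (fun t ht => (hH k (hSj k hk) t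
        (interior_subset ht)).differentiableAt.differentiableWithinAt)
      fun t ht => by
        rw [(hH k (hSj k hk) t (interior_subset ht)).deriv]
        exact hh0 k hk t (interior_subset ht)
    exact (hH0 k (hSj k hk)).trans (this self_mem_Ici hT hT)
  have hsum : ∑ k ∈ S, H k T ≤ J * B := by
    calc _ ≤ ∑ k ∈ S, B := Finset.sum_le_sum fun k hk => hHB k (hSj k hk) T hT
      _ = S.card * B := by simp
      _ ≤ _ := by gcongr
  have : 0 ≤ ∑ k ∈ S, H k T := Finset.sum_nonneg hHnn
  gcongr

lemma differentiable_W6 : Differentiable ℝ W6 := by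
  unfold W6
  refine Differentiable.inv ?_ fun x => by positivity
  have h : Differentiable ℝ fun x : E6 => ‖x‖ ^ 2 := differentiable_id.norm_sq ℝ
  simp only [div_eq_mul_inv]
  exact ((h.mul_const 24⁻¹).const_add 1).fun_pow 2

lemma LW6_eq (x : E6) : LW6 x = resonanceProfile 1 ‖x‖ := by
  have h1 : HasDerivAt (fun s : ℝ => W6 (s • x)) (fderiv ℝ W6 x x) 1 := by
    refine ((differentiable_W6 ((1 : ℝ) • x)).hasFDerivAt.comp_hasDerivAt (1 : ℝ)
      ((hasDerivAt_id (1 : ℝ)).smul_const x)).congr_deriv ?_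
    simp only [one_smul]
  have h2 : (fun s : ℝ => W6 (s • x)) = fun s : ℝ => ((1 + s ^ 2 * ‖x‖ ^ 2 / 24) ^ 2)⁻¹ := by
    funext s
    rw [W6, norm_smul, mul_pow, norm_eq_abs, sq_abs]
  rw [h2] at h1
  have h3 := ((((((hasDerivAt_id (1 : ℝ)).pow 2).mul_const (‖x‖ ^ 2)).div_const 24).const_add
    1).pow 2).inv (by simp; positivity)
  have h4 := h1.unique h3
  rw [LW6, h4, W6, resonanceProfile]
  simp
  field_simp
  ring

lemma rescH_LW6 {a : ℝ} (ha : 0 < a) (x : E6) : rescH a LW6 x = resonanceProfile a ‖x‖ := by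
  rw [rescH, LW6_eq, norm_smul, norm_inv, norm_eq_abs, abs_of_pos ha]
  unfold resonanceProfile
  field_simp

lemma rescL_LW6 {a : ℝ} (ha : 0 < a) (x : E6) :
    rescL a LW6 x = a⁻¹ * resonanceProfile a ‖x‖ := by
  rw [← rescH_LW6 ha, rescL, rescH]
  field_simp

lemma rescH_V6 {a : ℝ} (ha : 0 < a) (x : E6) : rescH a V6 x = -2 * solitonProfile a ‖x‖ := by
  rw [rescH, V6, W6, norm_smul, norm_inv, norm_eq_abs, abs_of_pos ha]
  unfold solitonProfile
  field_simp
  ring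

/-- The `i`-th vector of the standard basis of `E6`. -/
abbrev basisVec (i : Fin 6) : E6 := EuclideanSpace.single i (1 : ℝ)

lemma norm_smul_basisVec {r : ℝ} (hr : 0 ≤ r) (i : Fin 6) : ‖r • basisVec i‖ = r := by
  simp [norm_smul, abs_of_nonneg hr]

lemma norm_smul_add_smul_basisVec (r s : ℝ) {i : Fin 6} (hi : i ≠ 0) :
    ‖r • basisVec 0 + s • basisVec i‖ = √(r ^ 2 + s ^ 2) := by
  have h : ⟪r • basisVec 0, s • basisVec i⟫ = 0 := by
    simp [inner_smul_left, inner_smul_right, EuclideanSpace.inner_single_left, hi.symm]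
  rw [eq_comm, Real.sqrt_eq_iff_mul_self_eq (by positivity) (norm_nonneg _),
    norm_add_sq_eq_norm_sq_add_norm_sq_real h]
  simp [norm_smul]
  ring

lemma lap6_radial {f : E6 → ℝ} (hf : ContDiff ℝ 2 f) (hrad : ∀ x y, ‖x‖ = ‖y‖ → f x = f y)
    {g' g'' : ℝ → ℝ} (hg' : ∀ r, HasDerivAt (fun s : ℝ => f (s • basisVec 0)) (g' r) r)
    (hg'' : ∀ r, HasDerivAt g' (g'' r) r) {r : ℝ} (hr : 0 < r) :
    lap6 f (r • basisVec 0) = g'' r + 5 / r * g' r := by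
  have hline : ∀ (k : E6 → ℝ), ContDiff ℝ 1 k → ∀ (x e : E6) (s : ℝ),
      HasDerivAt (fun s : ℝ => k (x + s • e)) (fderiv ℝ k (x + s • e) e) s := by
    intro k hk x e s
    refine ((hk.differentiable (by simp) (x + s • e)).hasFDerivAt.comp_hasDerivAt s
      (((hasDerivAt_id s).smul_const e).const_add x)).congr_deriv ?_
    simp only [one_smul]
  have hf1 : ContDiff ℝ 1 f := hf.of_le (by norm_num)
  have hk : ∀ i, ContDiff ℝ 1 fun y => fderiv ℝ f y (basisVec i) := fun i =>
    contDiff_fderiv_apply_const hf _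
  have h0 : fderiv ℝ (fun y => fderiv ℝ f y (basisVec 0)) (r • basisVec 0) (basisVec 0) =
      g'' r := by
    have h := hline _ (hk 0) 0 (basisVec 0) r
    simp only [zero_add] at h
    have e : (fun s : ℝ => fderiv ℝ f (s • basisVec 0) (basisVec 0)) = g' := by
      funext s
      have h := hline f hf1 0 (basisVec 0) s
      simp only [zero_add] at h
      exact h.unique (hg' s)
    rw [e] at h
    exact h.unique (hg'' r)
  have hi : ∀ i : Fin 6, i ≠ 0 →
      fderiv ℝ (fun y => fderiv ℝ f y (basisVec i)) (r • basisVec 0) (basisVec i) =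
      g' r / r := by
    intro i hi
    have h := hline _ (hk i) (r • basisVec 0) (basisVec i) 0
    have hsq : ∀ s : ℝ, HasDerivAt (fun s : ℝ => √(r ^ 2 + s ^ 2)) (s / √(r ^ 2 + s ^ 2)) s := by
      intro s
      have hp : 0 < r ^ 2 + s ^ 2 := by positivity
      refine ((((hasDerivAt_id s).pow 2).const_add (r ^ 2)).sqrt
        (by simpa using hp.ne')).congr_deriv ?_
      simp
      field_simp
    have e : (fun s : ℝ => fderiv ℝ f (r • basisVec 0 + s • basisVec i) (basisVec i)) =
        fun s => g' (√(r ^ 2 + s ^ 2)) * (s / √(r ^ 2 + s ^ 2)) := by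
      funext s
      have h := hline f hf1 (r • basisVec 0) (basisVec i) s
      have e : (fun s : ℝ => f (r • basisVec 0 + s • basisVec i)) =
          fun s => f (√(r ^ 2 + s ^ 2) • basisVec 0) := by
        funext s
        apply hrad
        rw [norm_smul_add_smul_basisVec r s hi, norm_smul_basisVec (by positivity)]
      rw [e] at h
      exact h.unique ((hg' _).comp s (hsq s))
    rw [e] at h
    simp only [zero_smul, add_zero] at h
    have hr0 : √(r ^ 2 + 0 ^ 2) = r := by simp [Real.sqrt_sq hr.le]
    have h1 := (hg'' (√(r ^ 2 + 0 ^ 2))).comp 0 (hsq 0)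
    have h2 := (hasDerivAt_id (0 : ℝ)).div (hsq 0) (by rw [hr0]; exact hr.ne')
    refine h.unique ((h1.mul h2).congr_deriv ?_)
    simp only [hr0, id, Function.comp, zero_div, mul_zero, zero_mul, sub_zero, one_mul, zero_add]
    field_simp
  rw [lap6, Fin.sum_univ_succ, h0, Finset.sum_congr rfl fun i _ => hi i.succ (Fin.succ_ne_zero i)]
  simp
  ring

lemma norm_gradient_radial {u : E6 → ℝ} {m : ℝ → ℝ} (hu : ∀ y, u y = m ‖y‖) {x : E6}
    (hx : x ≠ 0) {m' : ℝ} (hm : HasDerivAt m m' ‖x‖) : ‖gradient u x‖ ^ 2 = m' ^ 2 := by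
  have hpos : 0 < ‖x‖ := norm_pos_iff.2 hx
  have hn : HasFDerivAt (fun y : E6 => ‖y‖) (‖x‖⁻¹ • innerSL ℝ x) x := by
    have h := (hasStrictFDerivAt_norm_sq x).hasFDerivAt.sqrt (by positivity)
    simp only [Real.sqrt_sq (norm_nonneg _)] at h
    refine h.congr_fderiv ?_
    ext y
    simp
    field_simp
  have hd : HasFDerivAt u (m' • (‖x‖⁻¹ • innerSL ℝ x)) x := by
    rw [show u = m ∘ fun y => ‖y‖ from funext hu]
    exact hm.comp_hasFDerivAt x hn
  rw [gradient, hd.fderiv, LinearIsometryEquiv.norm_map, norm_smul, norm_smul, innerSL_apply_norm,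
    norm_inv, norm_norm, inv_mul_cancel₀ hpos.ne', mul_one, norm_eq_abs, sq_abs]

lemma sqrt_integral_radial_exterior_le {G : ℝ → ℝ} {ρ M : ℝ} (hρ : 0 ≤ ρ)
    (hM : 0 ≤ M) (h : ∀ b, ρ < b → (∫ r in ρ..b, G r * r ^ 5) ≤ M ^ 2) :
    √(∫ x in {x : E6 | ρ < ‖x‖}, G ‖x‖) ≤
      √(6 * (volume : Measure E6).real (Metric.ball 0 1)) * M := by
  have h1 : (∫ x in {x : E6 | ρ < ‖x‖}, G ‖x‖) = ∫ x : E6, (Ioi ρ).indicator G ‖x‖ := by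
    rw [← integral_indicator (measurableSet_lt measurable_const measurable_norm)]
    rfl
  have h2 : ∫ y in Ioi (0 : ℝ), y ^ 5 • (Ioi ρ).indicator G y = ∫ y in Ioi ρ, G y * y ^ 5 := by
    have e : (fun y : ℝ => y ^ 5 • (Ioi ρ).indicator G y) =
        (Ioi ρ).indicator fun y => G y * y ^ 5 := by
      funext y
      by_cases hy : y ∈ Ioi ρ <;> simp [hy, mul_comm]
    rw [e, setIntegral_indicator measurableSet_Ioi, inter_eq_right.2 (Ioi_subset_Ioi hρ)]
  have h3 : ∫ y in Ioi ρ, G y * y ^ 5 ≤ M ^ 2 := by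
    by_cases hi : IntegrableOn (fun y => G y * y ^ 5) (Ioi ρ)
    · exact le_of_tendsto (intervalIntegral_tendsto_integral_Ioi ρ hi tendsto_id)
        ((eventually_gt_atTop ρ).mono fun b hb => h b hb)
    · rw [integral_undef hi]
      positivity
  rw [h1, integral_fun_norm_addHaar volume]
  simp only [finrank_euclideanSpace, Fintype.card_fin]
  rw [h2, nsmul_eq_mul, smul_eq_mul, ← mul_assoc]
  refine (Real.sqrt_le_sqrt (mul_le_mul_of_nonneg_left h3 (by positivity))).trans ?_
  rw [Real.sqrt_mul (by positivity), Real.sqrt_sq hM]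
  simp

lemma hasDerivAt_dtu {φ : ℝ → E6 → ℝ} (hφ : ContDiff ℝ 2 fun p : ℝ × E6 => φ p.1 p.2) (t : ℝ)
    (x : E6) : HasDerivAt (fun s => φ s x) (dtu φ t x) t := by
  have h : ContDiff ℝ 2 fun s => φ s x := hφ.comp (contDiff_id.prodMk contDiff_const)
  exact (h.differentiable (by simp) t).hasDerivAt

lemma hasDerivAt_dttu {φ : ℝ → E6 → ℝ} (hφ : ContDiff ℝ 2 fun p : ℝ × E6 => φ p.1 p.2) (t : ℝ)
    (x : E6) : HasDerivAt (fun s => dtu φ s x) (dttu φ t x) t := by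
  have h : ContDiff ℝ 2 fun s => φ s x := hφ.comp (contDiff_id.prodMk contDiff_const)
  have h' : ContDiff ℝ 1 (deriv fun s => φ s x) :=
    (contDiff_succ_iff_deriv (n := 1).1 h).2.2
  exact (h'.differentiable (by simp) t).hasDerivAt

theorem exterior_energy_le {J : ℕ} {lam : Fin J → ℝ} (hlam : ∀ k, 0 < lam k) (j : Fin J)
    {φ : ℝ → E6 → ℝ} (hφ : IsRadSolOf (Vmulti lam) φ) {α β : ℝ}
    (h0 : ∀ x, φ 0 x = β * resonanceProfile (lam j) ‖x‖)
    (h1 : ∀ x, dtu φ 0 x = α * resonanceProfile (lam j) ‖x‖)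
    {h H : Fin J → ℝ → ℝ} {B : ℝ} (hB : 0 ≤ B)
    (hs : ∀ k, k ≠ j → ∀ t, 0 ≤ t → (|α| * t + |β|) * (1327104 * min (lam k) (lam j) ^ 2 *
      max (lam k) (lam j) ^ 2 / ((min (lam k) (lam j) + t) *
        (max (lam k) (lam j) ^ 2 + t ^ 2) ^ 2)) ≤ h k t)
    (hH : ∀ k, k ≠ j → ∀ t, 0 ≤ t → HasDerivAt (H k) (h k t) t)
    (hH0 : ∀ k, k ≠ j → 0 ≤ H k 0) (hHB : ∀ k, k ≠ j → ∀ t, 0 ≤ t → H k t ≤ B) (t : ℝ) :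
    √(∫ x in {x : E6 | |t| < ‖x‖},
      ‖gradient (fun y => φ t y - (α * t + β) * resonanceProfile (lam j) ‖y‖) x‖ ^ 2 +
        (dtu φ t x - α * resonanceProfile (lam j) ‖x‖) ^ 2) ≤
      √(6 * (volume : Measure E6).real (Metric.ball 0 1)) * (exp (18 * J) * (J * (J * B))) := by
  obtain ⟨hreg, hrad, heq, -⟩ := hφ
  obtain ⟨σ, hσ, hσt⟩ : ∃ σ : ℝ, σ ^ 2 = 1 ∧ σ * |t| = t := by
    rcases le_total 0 t with ht | ht
    · exact ⟨1, by norm_num, by rw [abs_of_nonneg ht, one_mul]⟩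
    · exact ⟨-1, by norm_num, by rw [abs_of_nonpos ht]; ring⟩
  have hσabs : |σ| = 1 := by
    rw [← Real.sqrt_sq_eq_abs, hσ, Real.sqrt_one]
  have ha := hlam j
  set g := resonanceProfile (lam j) with hg
  set v : ℝ × ℝ → ℝ := fun z => φ (σ * z.1) (z.2 • basisVec 0) - (α * (σ * z.1) + β) * g z.2
    with hvdef
  have hv : ContDiff ℝ 2 v := by
    have hg2 : ContDiff ℝ 2 g := contDiff_resonanceProfile ha
    refine ContDiff.sub ?_ ?_
    · exact hreg.comp (f := fun z : ℝ × ℝ => (σ * z.1, z.2 • basisVec 0)) (by fun_prop)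
    · fun_prop
  have hv1 : ContDiff ℝ 1 v := hv.of_le (by norm_num)
  have hT : ∀ t r, partialT v (t, r) = σ * (dtu φ (σ * t) (r • basisVec 0) - α * g r) := by
    intro t r
    have hd := (hasDerivAt_id t).const_mul σ
    refine (hasDerivAt_partialT_left hv1 t r).unique ((((hasDerivAt_dtu hreg (σ * t)
      (r • basisVec 0)).comp t hd).sub (((hd.const_mul α).add_const β).mul_const
        (g r))).congr_deriv ?_)
    ring
  have hTT : ∀ t r, partialT (partialT v) (t, r) = dttu φ (σ * t) (r • basisVec 0) := by
    intro t r
    have hd := (hasDerivAt_id t).const_mul σ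
    have hp := hasDerivAt_partialT_left (contDiff_partialT hv) t r
    simp only [hT] at hp
    refine hp.unique (((((hasDerivAt_dttu hreg (σ * t)
      (r • basisVec 0)).comp t hd).sub_const (α * g r)).const_mul σ).congr_deriv ?_)
    linear_combination dttu φ (σ * t) (r • basisVec 0) * hσ
  have hlap : ∀ t r, 0 < r → lap6 (φ (σ * t)) (r • basisVec 0) =
      partialR (partialR v) (t, r) + 5 / r * partialR v (t, r) +
        (α * (σ * t) + β) * (-2 * solitonProfile (lam j) r * g r) := by
    intro t r hr
    have hf : ContDiff ℝ 2 (φ (σ * t)) :=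
      hreg.comp (f := fun x : E6 => (σ * t, x)) (by fun_prop)
    have e : (fun s : ℝ => φ (σ * t) (s • basisVec 0)) =
        fun s => v (t, s) + (α * (σ * t) + β) * g s := by
      funext s
      simp [hvdef]
    rw [lap6_radial hf (hrad _)
      (g' := fun r => partialR v (t, r) + (α * (σ * t) + β) * resonanceProfileDeriv (lam j) r)
      (g'' := fun r => partialR (partialR v) (t, r) +
        (α * (σ * t) + β) * resonanceProfileDeriv₂ (lam j) r) ?_ ?_ hr, hg,
      ← resonanceProfile_ode ha hr]
    · ring
    · intro r
      rw [e]
      exact (hasDerivAt_partialR_right hv1 t r).add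
        ((hasDerivAt_resonanceProfile ha r).const_mul _)
    · intro r
      exact (hasDerivAt_partialR_right (contDiff_partialR hv) t r).add
        ((hasDerivAt_resonanceProfileDeriv ha r).const_mul _)
  have hpde : ∀ t r, 0 < r → partialT (partialT v) (t, r) - partialR (partialR v) (t, r)
      - 5 / r * partialR v (t, r) + (∑ k, -2 * solitonProfile (lam k) r) * v (t, r) =
      (α * (σ * t) + β) * ∑ k ∈ Finset.univ.erase j, 2 * solitonProfile (lam k) r * g r := by
    intro t r hr
    have hV : Vmulti lam (r • basisVec 0) = ∑ k, -2 * solitonProfile (lam k) r :=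
      Finset.sum_congr rfl fun k _ => by rw [rescH_V6 (hlam k), norm_smul_basisVec hr.le]
    have hsum : ∑ k, -2 * solitonProfile (lam k) r * g r = -2 * solitonProfile (lam j) r * g r -
        ∑ k ∈ Finset.univ.erase j, 2 * solitonProfile (lam k) r * g r := by
      rw [← Finset.add_sum_erase _ _ (Finset.mem_univ j), sub_eq_add_neg, ← Finset.sum_neg_distrib]
      simp only [neg_mul]
    rw [← Finset.sum_mul] at hsum
    have h := heq (σ * t) (r • basisVec 0)
    rw [hlap t r hr, hV] at h
    rw [hTT]
    simp only [hvdef] at h ⊢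
    linear_combination h - (α * (σ * t) + β) * hsum
  have hM : 0 ≤ exp (18 * J) * (J * (J * B)) := by positivity
  have hmain := fun b (hb : |t| < b) => multisoliton_cone_bound hlam j
    (s := fun t => α * (σ * t) + β) hB
    (fun k hk t ht => (mul_le_mul_of_nonneg_right (by
      refine (abs_add_le _ _).trans_eq ?_
      rw [abs_mul, abs_mul, hσabs, one_mul, abs_of_nonneg ht]) (by
      have := hlam k
      positivity)).trans (hs k hk t ht)) hH hH0 hHB hv
    (fun r => by simp [hvdef, h0, norm_smul, hg, resonanceProfile])
    (fun r => by simp [hT, h1, norm_smul, hg, resonanceProfile]) hpde (abs_nonneg t) hb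
  refine le_of_eq_of_le (congrArg _ ?_) (sqrt_integral_radial_exterior_le
    (G := fun r => partialT v (|t|, r) ^ 2 + partialR v (|t|, r) ^ 2) (abs_nonneg t) hM
    fun b hb => (hmain b hb).trans_eq ?_)
  · refine setIntegral_congr_fun (measurableSet_lt measurable_const measurable_norm)
      fun x hx => ?_
    have hx0 : x ≠ 0 := norm_pos_iff.1 ((abs_nonneg t).trans_lt hx)
    have hn : ∀ y : E6, ‖‖y‖ • basisVec 0‖ = ‖y‖ := fun y =>
      norm_smul_basisVec (norm_nonneg y) 0
    have hd : dtu φ t (‖x‖ • basisVec 0) = dtu φ t x :=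
      congrArg (fun f => deriv f t) (funext fun s => hrad s _ _ (hn x))
    simp only [hT, hσt, hd]
    rw [norm_gradient_radial (m := fun r => v (|t|, r)) (fun y => ?_) hx0
      (hasDerivAt_partialR_right hv1 _ _), mul_pow, hσ]
    · ring
    · simp only [hvdef, hσt]
      rw [hrad t _ _ (hn y)]
  · rw [two_mul (18 * (J : ℝ)), Real.exp_add]
    ring

lemma gam_nonneg {J : ℕ} {lam : Fin J → ℝ} (hlam : ∀ k, 0 < lam k) : 0 ≤ gam lam := by
  refine Real.sSup_nonneg ?_
  rintro _ ⟨i, hi, rfl⟩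
  exact (div_pos (hlam _) (hlam _)).le

lemma div_le_gam {J : ℕ} {lam : Fin J → ℝ} (hlam : ∀ k, 0 < lam k) (hanti : StrictAnti lam)
    {i k : Fin J} (hik : i < k) : lam k / lam i ≤ gam lam := by
  have hi : (i : ℕ) + 1 < J := (Nat.succ_le_of_lt hik).trans_lt k.isLt
  have hle : lam k ≤ lam ⟨(i : ℕ) + 1, hi⟩ := hanti.antitone (Nat.succ_le_of_lt hik)
  refine (div_le_div_of_nonneg_right hle (hlam i).le).trans (le_csSup ⟨1, ?_⟩ ⟨i, hi, rfl⟩)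
  rintro _ ⟨l, hl, rfl⟩
  exact (div_le_one (hlam l)).2 (hanti.antitone (Nat.le_succ l))

lemma min_lt_max_and_div_le_gam {J : ℕ} {lam : Fin J → ℝ} (hlam : ∀ k, 0 < lam k)
    (hanti : StrictAnti lam) {i k : Fin J} (hik : k ≠ i) :
    min (lam k) (lam i) < max (lam k) (lam i) ∧
      min (lam k) (lam i) / max (lam k) (lam i) ≤ gam lam := by
  rcases hik.lt_or_gt with h | h
  · rw [min_eq_right (hanti h).le, max_eq_left (hanti h).le]
    exact ⟨hanti h, div_le_gam hlam hanti h⟩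
  · rw [min_eq_left (hanti h).le, max_eq_right (hanti h).le]
    exact ⟨hanti h, div_le_gam hlam hanti h⟩

/-- Approximate resonances of the multisoliton linearized equation. -/
theorem stmt15 (J : ℕ) (hJ : 0 < J) :
    ∃ γs C : ℝ, 0 < γs ∧ 0 < C ∧
      ∀ lam : Fin J → ℝ, (∀ j, 0 < lam j) → StrictAnti lam → gam lam ≤ γs →
        ∀ j : Fin J,
          (∀ φ : ℝ → E6 → ℝ, IsRadSolOf (Vmulti lam) φ →
            (∀ x, φ 0 x = 0) → (∀ x, dtu φ 0 x = rescL (lam j) LW6 x) →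
            ∀ t : ℝ,
              Real.sqrt (∫ x in {x : E6 | |t| < ‖x‖},
                  ‖gradient (fun y => φ t y - t * rescL (lam j) LW6 y) x‖ ^ 2 +
                    (dtu φ t x - rescL (lam j) LW6 x) ^ 2) ≤ C * gam lam) ∧
          (∀ ψ : ℝ → E6 → ℝ, IsRadSolOf (Vmulti lam) ψ →
            (∀ x, ψ 0 x = rescH (lam j) LW6 x) → (∀ x, dtu ψ 0 x = 0) →
            ∀ t : ℝ,
              Real.sqrt (∫ x in {x : E6 | |t| < ‖x‖},
                  ‖gradient (fun y => ψ t y - rescH (lam j) LW6 y) x‖ ^ 2 +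
                    dtu ψ t x ^ 2) ≤ C * gam lam ^ 2 * |Real.log (gam lam)|) := by
  set K := √(6 * (volume : Measure E6).real (Metric.ball 0 1)) * (exp (18 * J) * (J * J))
    with hK
  have hK0 : 0 ≤ K := by positivity
  refine ⟨1 / 4, 5308416 * K + 1, by norm_num, by positivity,
    fun lam hlam hanti hg j => ⟨fun φ hφ h0 h1 t => ?_, fun ψ hψ h0 h1 t => ?_⟩⟩
  · have hg0 := gam_nonneg hlam
    have key := exterior_energy_le hlam j hφ (α := (lam j)⁻¹) (β := 0)
      (fun x => by rw [h0, zero_mul]) (fun x => by rw [h1, rescL_LW6 (hlam j)])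
      (h := fun k t => 1327104 * min (lam k) (lam j) / (max (lam k) (lam j) ^ 2 + t ^ 2))
      (H := fun k t => 1327104 * (min (lam k) (lam j) / max (lam k) (lam j)) *
        arctan (t / max (lam k) (lam j)))
      (B := 2654208 * gam lam) (by positivity)
      (fun k _ t ht => by
        refine le_of_eq_of_le ?_ (source_linear_bound (lt_min (hlam k) (hlam j))
          (lt_max_of_lt_left (hlam k)) (min_le_right (lam k) (lam j)) ht)
        rw [abs_zero, add_zero, abs_of_pos (inv_pos.2 (hlam j)), inv_mul_eq_div])
      (fun k _ t _ => hasDerivAt_linear_primitive (lt_max_of_lt_left (hlam k)) _ t)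
      (fun k _ => by simp)
      (fun k hk t _ => by
        have h2 : arctan (t / max (lam k) (lam j)) ≤ 2 :=
          (arctan_lt_pi_div_two _).le.trans (by linarith [Real.pi_le_four])
        have hmin := lt_min (hlam k) (hlam j)
        have hmax : 0 < max (lam k) (lam j) := lt_max_of_lt_left (hlam k)
        calc _ ≤ 1327104 * (min (lam k) (lam j) / max (lam k) (lam j)) * 2 := by gcongr
          _ ≤ 1327104 * gam lam * 2 := by
            gcongr
            exact (min_lt_max_and_div_le_gam hlam hanti hk).2
          _ = 2654208 * gam lam := by ring) t
    have e : ∀ y : E6, (lam j)⁻¹ * t * resonanceProfile (lam j) ‖y‖ =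
        t * rescL (lam j) LW6 y := fun y => by
      rw [rescL_LW6 (hlam j)]
      ring
    simp only [add_zero, e, ← rescL_LW6 (hlam j)] at key
    refine key.trans ?_
    calc _ = 2654208 * K * gam lam := by rw [hK]; ring
      _ ≤ (5308416 * K + 1) * gam lam := by gcongr; linarith
  · have hg0 := gam_nonneg hlam
    have key := exterior_energy_le hlam j hψ (α := 0) (β := 1)
      (fun x => by rw [h0, one_mul, rescH_LW6 (hlam j)]) (fun x => by rw [h1, zero_mul])
      (h := fun k t => 2654208 * min (lam k) (lam j) ^ 2 / max (lam k) (lam j) /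
        ((min (lam k) (lam j) + t) * (max (lam k) (lam j) + t)))
      (H := fun k t => 2654208 * min (lam k) (lam j) ^ 2 /
        (max (lam k) (lam j) * (max (lam k) (lam j) - min (lam k) (lam j))) *
        (Real.log ((min (lam k) (lam j) + t) / (max (lam k) (lam j) + t)) -
          Real.log (min (lam k) (lam j) / max (lam k) (lam j))))
      (B := 5308416 * (gam lam ^ 2 * |Real.log (gam lam)|)) (by positivity)
      (fun k _ t ht => by
        rw [abs_zero, zero_mul, zero_add, abs_one, one_mul]
        exact source_static_bound (lt_min (hlam k) (hlam j)) (lt_max_of_lt_left (hlam k)) ht)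
      (fun k hk t ht => hasDerivAt_static_primitive (lt_min (hlam k) (hlam j))
        (min_lt_max_and_div_le_gam hlam hanti hk).1 ht)
      (fun k _ => by simp)
      (fun k hk t ht => static_primitive_le (lt_min (hlam k) (hlam j))
        (min_lt_max_and_div_le_gam hlam hanti hk).2 (lt_max_of_lt_left (hlam k)) hg ht) t
    simp only [← rescH_LW6 (hlam j), zero_mul, zero_add, one_mul, sub_zero] at key
    refine key.trans ?_
    have hL : 0 ≤ gam lam ^ 2 * |Real.log (gam lam)| := by positivity
    calc _ = 5308416 * K * (gam lam ^ 2 * |Real.log (gam lam)|) := by rw [hK]; ring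
      _ ≤ (5308416 * K + 1) * (gam lam ^ 2 * |Real.log (gam lam)|) := by gcongr; linarith
      _ = _ := by ring

end
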